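/- Fix λ > 0, a Borel probability measure F on [0,∞) with ∫ r^d F(dr) < ∞ that follows a power law with tail exponent α > d, and a probability kernel G = (G_r)_{r≥0} on [0,∞), and let h, q, λ_th = λ ∫ h(r) F(dr), and ξ_th(z) = (λ/λ_th)² ∬ q(|z|, r₁, r₂) F(dr₁) F(dr₂) be defined by the explicit formulas below. Assume there is a function q_∞ : [0,∞)² → ℝ such that for all r₁, r₂ ≥ 0, q(|z|, r₁, r₂)/(|z|^d·F̄(|z|)) → q_∞(r₁, r₂) as |z| → ∞. Then ξ_th(z)/(|z|^d·F̄(|z|)) → c as |z| → ∞, where c = (λ/λ_th)²·∬ q_∞(r₁, r₂) F(dr₁) F(dr₂). -/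

import Mathlib

open MeasureTheory Filter Set Metric ProbabilityTheory

noncomputable section

/-- A measurable positive function is slowly varying at infinity if `ℓ(a t)/ℓ(t) → 1`
as `t → ∞` for every `a > 0`. -/
def SlowlyVarying (ℓ : ℝ → ℝ) : Prop :=
  Measurable ℓ ∧ (∀ x > 0, 0 < ℓ x) ∧
    ∀ a > 0, Tendsto (fun t => ℓ (a * t) / ℓ t) atTop (nhds 1)

/-- Tail function `F̄(x) = F((x,∞))` of a measure on `ℝ`. -/
def tailF (F : Measure ℝ) (x : ℝ) : ℝ := (F (Ioi x)).toReal

/-- `d`-dimensional Euclidean space. -/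
abbrev Euc (d : ℕ) := EuclideanSpace ℝ (Fin d)

/-- The first standard basis vector of `ℝ^d`. -/
def e1 (d : ℕ) : Euc d := if h : 0 < d then EuclideanSpace.single (⟨0, h⟩ : Fin d) 1 else 0

/-- Volume of the closed ball of radius `r` in `ℝ^d`. -/
def ballVol (d : ℕ) (r : ℝ) : ℝ := (volume (closedBall (0 : Euc d) r)).toReal

/-- Volume of the intersection of closed balls `B_r(x)` and `B_s(y)` in `ℝ^d`. -/
def interVol (d : ℕ) (x : Euc d) (r : ℝ) (y : Euc d) (s : ℝ) : ℝ :=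
  (volume (closedBall x r ∩ closedBall y s)).toReal

/-- The constant `c_{α,d} = ∫₀^∞ |B_r(0) ∩ B_r(e₁)| α r^{-α-1} dr`. -/
def cconst (d : ℕ) (α : ℝ) : ℝ :=
  ∫ r in Ioi (0 : ℝ), interVol d 0 r (e1 d) r * (α * r ^ (-α - 1))

/-- `F` follows a power law with tail exponent `α`: `F̄(r) = ℓ(r) r^{-α}` with `ℓ`
slowly varying. -/
def IsPowerLaw (F : Measure ℝ) (α : ℝ) : Prop :=
  ∃ ℓ : ℝ → ℝ, SlowlyVarying ℓ ∧ ∀ x > 0, tailF F x = ℓ x * x ^ (-α)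

/-- Retention probability of a grain with radius `r` and weight `w`. -/
def hret (d : ℕ) (lam : ℝ) (F : Measure ℝ) (G : Kernel ℝ ℝ) (r w : ℝ) : ℝ :=
  Real.exp (-(lam * ∫ s, ballVol d (r + s) * ((G s) (Ici w)).toReal ∂F))

/-- Weight-averaged retention probability of a grain with radius `r`. -/
def havg (d : ℕ) (lam : ℝ) (F : Measure ℝ) (G : Kernel ℝ ℝ) (r : ℝ) : ℝ :=
  ∫ w, hret d lam F G r w ∂(G r)

/-- Pair retention probability of grains with radii `r₁, r₂`, weights `w₁, w₂` and
centers at distance `u` apart. -/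
def h2ret (d : ℕ) (lam : ℝ) (F : Measure ℝ) (G : Kernel ℝ ℝ)
    (u r₁ w₁ r₂ w₂ : ℝ) : ℝ :=
  if u ≤ r₁ + r₂ then 0
  else
    hret d lam F G r₁ w₁ * hret d lam F G r₂ w₂ *
      Real.exp (lam * ∫ r, interVol d 0 (r + r₁) (u • e1 d) (r + r₂) *
        ((G r) (Ici (max w₁ w₂))).toReal ∂F)

/-- Weight-averaged pair retention probability. -/
def h2avg (d : ℕ) (lam : ℝ) (F : Measure ℝ) (G : Kernel ℝ ℝ) (u r₁ r₂ : ℝ) : ℝ :=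
  ∫ w₁, ∫ w₂, h2ret d lam F G u r₁ w₁ r₂ w₂ ∂(G r₂) ∂(G r₁)

/-- Retention covariance function `q(u,r₁,r₂) = h₂(u,r₁,r₂) - h(r₁) h(r₂)`. -/
def qret (d : ℕ) (lam : ℝ) (F : Measure ℝ) (G : Kernel ℝ ℝ) (u r₁ r₂ : ℝ) : ℝ :=
  h2avg d lam F G u r₁ r₂ - havg d lam F G r₁ * havg d lam F G r₂

/-- Thinned germ density `λ_th = λ ∫ h(r) F(dr)`. -/
def lamth (lam : ℝ) (F : Measure ℝ) (h : ℝ → ℝ) : ℝ := lam * ∫ r, h r ∂F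

/-- Tail distribution `F̄_th(r) = (λ/λ_th) ∫_{(r,∞)} h(s) F(ds)` of the radius of a
typical grain in the thinned model. -/
def tailth (lam : ℝ) (F : Measure ℝ) (h : ℝ → ℝ) (r : ℝ) : ℝ :=
  (lam / lamth lam F h) * ∫ s in Ioi r, h s ∂F

/-- Volume fraction `p_th = λ ∫ |B_r(0)| h(r) F(dr)` of the thinned grain cover. -/
def pth (d : ℕ) (lam : ℝ) (F : Measure ℝ) (h : ℝ → ℝ) : ℝ :=
  lam * ∫ r, ballVol d r * h r ∂F

/-- Covariance function of the thinned grain cover. -/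
def kth (d : ℕ) (lam : ℝ) (F : Measure ℝ) (h : ℝ → ℝ) (q : ℝ → ℝ → ℝ → ℝ)
    (z : Euc d) : ℝ :=
  lam * ∫ r, interVol d 0 r z r * h r ∂F +
    lam ^ 2 * ∫ r₁, (∫ r₂, (∫ x, interVol d 0 r₁ x r₂ * q (‖x - z‖) r₁ r₂) ∂F) ∂F

/-- Two-point correlation function of the thinned grain centers. -/
def xith (d : ℕ) (lam : ℝ) (F : Measure ℝ) (h : ℝ → ℝ) (q : ℝ → ℝ → ℝ → ℝ)
    (z : Euc d) : ℝ :=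
  (lam / lamth lam F h) ^ 2 * ∫ r₁, (∫ r₂, q ‖z‖ r₁ r₂ ∂F) ∂F

lemma meas_ker (G : Kernel ℝ ℝ) [IsMarkovKernel G] {X : Type*} [MeasurableSpace X]
    {f g : X → ℝ} (hf : Measurable f) (hg : Measurable g) :
    Measurable (fun x => ((G (f x)) (Ici (g x))).toReal) := by
  have h := ProbabilityTheory.Kernel.measurable_kernel_prodMk_left
    (κ := Kernel.comap G f hf) (t := {p : X × ℝ | g p.1 ≤ p.2})
    (measurableSet_le (hg.comp measurable_fst) measurable_snd)
  exact h.ennreal_toReal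

lemma meas_ballVol (d : ℕ) {X : Type*} [MeasurableSpace X]
    {f : X → ℝ} (hf : Measurable f) : Measurable (fun x => ballVol d (f x)) := by
  have h := measurable_measure_prodMk_left (ν := (volume : Measure (Euc d)))
    (s := {p : X × Euc d | dist p.2 0 ≤ f p.1})
    (measurableSet_le (measurable_snd.dist measurable_const) (hf.comp measurable_fst))
  exact h.ennreal_toReal

lemma meas_interVol (d : ℕ) (y : Euc d) {X : Type*} [MeasurableSpace X]
    {f g : X → ℝ} (hf : Measurable f) (hg : Measurable g) :
    Measurable (fun x => interVol d 0 (f x) y (g x)) := by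
  have h := measurable_measure_prodMk_left (ν := (volume : Measure (Euc d)))
    (s := {p : X × Euc d | dist p.2 0 ≤ f p.1} ∩ {p : X × Euc d | dist p.2 y ≤ g p.1})
    ((measurableSet_le (measurable_snd.dist measurable_const) (hf.comp measurable_fst)).inter
    (measurableSet_le (measurable_snd.dist measurable_const) (hg.comp measurable_fst)))
  exact h.ennreal_toReal

lemma meas_hret (d : ℕ) (lam : ℝ) (F : Measure ℝ) [IsProbabilityMeasure F]
    (G : Kernel ℝ ℝ) [IsMarkovKernel G] {X : Type*} [MeasurableSpace X]
    {f g : X → ℝ} (hf : Measurable f) (hg : Measurable g) :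
    Measurable (fun x => hret d lam F G (f x) (g x)) := by
  unfold hret
  have h : Measurable (fun p : X × ℝ =>
      ballVol d (f p.1 + p.2) * ((G p.2) (Ici (g p.1))).toReal) :=
    (meas_ballVol d ((hf.comp measurable_fst).add measurable_snd)).mul
      (meas_ker G measurable_snd (hg.comp measurable_fst))
  have h2 := (h.stronglyMeasurable.integral_prod_right' (ν := F)).measurable
  exact ((h2.const_mul lam).neg).exp

lemma meas_havg (d : ℕ) (lam : ℝ) (F : Measure ℝ) [IsProbabilityMeasure F]
    (G : Kernel ℝ ℝ) [IsMarkovKernel G] : Measurable (havg d lam F G) := by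
  have h := meas_hret d lam F G (measurable_fst (α := ℝ) (β := ℝ)) measurable_snd
  exact (h.stronglyMeasurable.integral_kernel_prod_right' (κ := G)).measurable

/-- the exponent in the pair retention probability -/
def IE (d : ℕ) (F : Measure ℝ) (G : Kernel ℝ ℝ) (u r₁ r₂ w : ℝ) : ℝ :=
  ∫ r, interVol d 0 (r + r₁) (u • e1 d) (r + r₂) * ((G r) (Ici w)).toReal ∂F

lemma meas_h2ret (d : ℕ) (lam : ℝ) (F : Measure ℝ) [IsProbabilityMeasure F]
    (G : Kernel ℝ ℝ) [IsMarkovKernel G] (u : ℝ) {X : Type*} [MeasurableSpace X]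
    {f₁ g₁ f₂ g₂ : X → ℝ} (hf₁ : Measurable f₁) (hg₁ : Measurable g₁)
    (hf₂ : Measurable f₂) (hg₂ : Measurable g₂) :
    Measurable (fun x => h2ret d lam F G u (f₁ x) (g₁ x) (f₂ x) (g₂ x)) := by
  unfold h2ret
  refine Measurable.ite (measurableSet_le measurable_const (hf₁.add hf₂)) measurable_const ?_
  refine ((meas_hret d lam F G hf₁ hg₁).mul (meas_hret d lam F G hf₂ hg₂)).mul ?_
  have h : Measurable (fun p : X × ℝ =>
      interVol d 0 (p.2 + f₁ p.1) (u • e1 d) (p.2 + f₂ p.1) *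
        ((G p.2) (Ici (max (g₁ p.1) (g₂ p.1)))).toReal) :=
    (meas_interVol d _ (measurable_snd.add (hf₁.comp measurable_fst))
      (measurable_snd.add (hf₂.comp measurable_fst))).mul
      (meas_ker G measurable_snd ((hg₁.max hg₂).comp measurable_fst))
  have h2 := (h.stronglyMeasurable.integral_prod_right' (ν := F)).measurable
  exact (h2.const_mul lam).exp

lemma meas_qret (d : ℕ) (lam : ℝ) (F : Measure ℝ) [IsProbabilityMeasure F]
    (G : Kernel ℝ ℝ) [IsMarkovKernel G] (u : ℝ) :
    Measurable (fun p : ℝ × ℝ => qret d lam F G u p.1 p.2) := by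
  unfold qret
  refine Measurable.sub ?_ (((meas_havg d lam F G).comp measurable_fst).mul
    ((meas_havg d lam F G).comp measurable_snd))
  unfold h2avg
  have h : Measurable (fun x : ((ℝ × ℝ) × ℝ) × ℝ =>
      h2ret d lam F G u x.1.1.1 x.1.2 x.1.1.2 x.2) :=
    meas_h2ret d lam F G u (by fun_prop) (by fun_prop) (by fun_prop) (by fun_prop)
  have h1 := h.stronglyMeasurable.integral_kernel_prod_right'
    (κ := Kernel.comap G (fun x : (ℝ × ℝ) × ℝ => x.1.2) (by fun_prop))
  have h2 := h1.integral_kernel_prod_right'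
    (κ := Kernel.comap G (fun x : ℝ × ℝ => x.1) (by fun_prop))
  exact h2.measurable

/-- volume of the unit ball -/
def kap (d : ℕ) : ℝ := (volume (closedBall (0 : Euc d) 1)).toReal

lemma kap_nonneg (d : ℕ) : 0 ≤ kap d := ENNReal.toReal_nonneg

lemma ballVol_nonneg (d : ℕ) (r : ℝ) : 0 ≤ ballVol d r := ENNReal.toReal_nonneg

lemma interVol_nonneg (d : ℕ) (x y : Euc d) (r s : ℝ) : 0 ≤ interVol d x r y s :=
  ENNReal.toReal_nonneg

lemma ballVol_le (d : ℕ) {r s : ℝ} (hrs : r ≤ s) (hs : 0 ≤ s) :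
    ballVol d r ≤ kap d * s ^ d := by
  have h1 : ballVol d r ≤ ballVol d s := by
    unfold ballVol
    exact ENNReal.toReal_mono measure_closedBall_lt_top.ne
      (measure_mono (closedBall_subset_closedBall hrs))
  refine h1.trans (le_of_eq ?_)
  unfold ballVol kap
  rw [Measure.addHaar_closedBall' _ _ hs, ENNReal.toReal_mul,
    ENNReal.toReal_ofReal (by positivity)]
  simp [mul_comm]

lemma interVol_le_left (d : ℕ) (y : Euc d) (r s : ℝ) : interVol d 0 r y s ≤ ballVol d r :=
  ENNReal.toReal_mono measure_closedBall_lt_top.ne (measure_mono inter_subset_left)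

lemma ker_le_one (G : Kernel ℝ ℝ) [IsMarkovKernel G] (r : ℝ) (s : Set ℝ) :
    ((G r) s).toReal ≤ 1 := by
  have := ENNReal.toReal_mono ENNReal.one_ne_top (prob_le_one (μ := G r) (s := s))
  simpa using this

lemma integrable_ball (d : ℕ) (F : Measure ℝ) [IsProbabilityMeasure F]
    (hmom : Integrable (fun r : ℝ => r ^ d) F)
    (G : Kernel ℝ ℝ) [IsMarkovKernel G] (r w : ℝ) :
    Integrable (fun s => ballVol d (r + s) * ((G s) (Ici w)).toReal) F := by
  have hb : Integrable (fun s : ℝ => kap d * (2 ^ (d - 1) * (|r| ^ d + |s| ^ d))) F := by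
    have h : Integrable (fun s : ℝ => |s| ^ d) F := by
      have := hmom.norm
      simpa [Real.norm_eq_abs, abs_pow] using this
    exact (((integrable_const _).add h).const_mul _).const_mul _
  refine hb.mono' ?_ ?_
  · exact ((meas_ballVol d (by fun_prop)).mul
      (meas_ker G measurable_id measurable_const)).aestronglyMeasurable
  · refine Eventually.of_forall fun s => ?_
    rw [Real.norm_of_nonneg (mul_nonneg (ballVol_nonneg _ _) ENNReal.toReal_nonneg)]
    have h1 : ballVol d (r + s) ≤ kap d * (|r| + |s|) ^ d :=
      ballVol_le d ((le_abs_self _).trans (abs_add_le _ _)) (by positivity)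
    have h2 := add_pow_le (abs_nonneg r) (abs_nonneg s) d
    calc _ ≤ ballVol d (r + s) * 1 :=
          mul_le_mul_of_nonneg_left (ker_le_one _ _ _) (ballVol_nonneg _ _)
      _ ≤ kap d * (|r| + |s|) ^ d := by rwa [mul_one]
      _ ≤ _ := mul_le_mul_of_nonneg_left h2 (kap_nonneg d)

lemma IE_nonneg (d : ℕ) (F : Measure ℝ) (G : Kernel ℝ ℝ) (u r₁ r₂ w : ℝ) :
    0 ≤ IE d F G u r₁ r₂ w :=
  integral_nonneg fun _ => mul_nonneg (interVol_nonneg _ _ _ _ _) ENNReal.toReal_nonneg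

lemma hret_pos (d : ℕ) (lam : ℝ) (F : Measure ℝ) (G : Kernel ℝ ℝ) (r w : ℝ) :
    0 < hret d lam F G r w := Real.exp_pos _

lemma hret_le_one (d : ℕ) (lam : ℝ) (hlam : 0 < lam) (F : Measure ℝ) (G : Kernel ℝ ℝ)
    (r w : ℝ) : hret d lam F G r w ≤ 1 := by
  unfold hret
  rw [Real.exp_le_one_iff, neg_nonpos]
  exact mul_nonneg hlam.le (integral_nonneg fun _ =>
    mul_nonneg (ballVol_nonneg _ _) ENNReal.toReal_nonneg)

lemma hret_mul_exp_le_one (d : ℕ) (lam : ℝ) (hlam : 0 < lam) (F : Measure ℝ)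
    [IsProbabilityMeasure F] (hmom : Integrable (fun r : ℝ => r ^ d) F)
    (G : Kernel ℝ ℝ) [IsMarkovKernel G] (u r₁ r₂ w₁ w₂ : ℝ) :
    hret d lam F G r₁ w₁ * Real.exp (lam * IE d F G u r₁ r₂ (max w₁ w₂)) ≤ 1 := by
  unfold hret
  rw [← Real.exp_add, Real.exp_le_one_iff]
  have : IE d F G u r₁ r₂ (max w₁ w₂) ≤
      ∫ s, ballVol d (r₁ + s) * ((G s) (Ici w₁)).toReal ∂F := by
    refine integral_mono_of_nonneg (Eventually.of_forall fun _ =>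
      mul_nonneg (interVol_nonneg _ _ _ _ _) ENNReal.toReal_nonneg)
      (integrable_ball d F hmom G r₁ w₁) (Eventually.of_forall fun s => ?_)
    refine mul_le_mul ?_ ?_ ENNReal.toReal_nonneg (ballVol_nonneg _ _)
    · rw [add_comm r₁ s]; exact interVol_le_left _ _ _ _
    · exact ENNReal.toReal_mono (measure_ne_top _ _)
        (measure_mono (Ici_subset_Ici.2 (le_max_left _ _)))
  have := mul_le_mul_of_nonneg_left this hlam.le
  linarith

lemma h2ret_nonneg (d : ℕ) (lam : ℝ) (F : Measure ℝ) (G : Kernel ℝ ℝ) (u r₁ w₁ r₂ w₂ : ℝ) :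
    0 ≤ h2ret d lam F G u r₁ w₁ r₂ w₂ := by
  unfold h2ret
  split_ifs
  · exact le_rfl
  · exact mul_nonneg (mul_nonneg (hret_pos _ _ _ _ _ _).le (hret_pos _ _ _ _ _ _).le)
      (Real.exp_pos _).le

lemma h2ret_le_one (d : ℕ) (lam : ℝ) (hlam : 0 < lam) (F : Measure ℝ)
    [IsProbabilityMeasure F] (hmom : Integrable (fun r : ℝ => r ^ d) F)
    (G : Kernel ℝ ℝ) [IsMarkovKernel G] (u r₁ w₁ r₂ w₂ : ℝ) :
    h2ret d lam F G u r₁ w₁ r₂ w₂ ≤ 1 := by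
  unfold h2ret
  split_ifs
  · exact zero_le_one
  · have h1 := hret_mul_exp_le_one d lam hlam F hmom G u r₁ r₂ w₁ w₂
    have h2 := hret_le_one d lam hlam F G r₂ w₂
    have h3 := hret_pos d lam F G r₂ w₂
    have h4 := hret_pos d lam F G r₁ w₁
    have h5 := Real.exp_pos (lam * IE d F G u r₁ r₂ (max w₁ w₂))
    unfold IE at h1 h5
    calc _ = (hret d lam F G r₁ w₁ * Real.exp _) * hret d lam F G r₂ w₂ := by
          rw [mul_right_comm]
      _ ≤ 1 * 1 := mul_le_mul h1 h2 h3.le zero_le_one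
      _ = 1 := one_mul 1

lemma int_le_one {X : Type*} [MeasurableSpace X] (μ : Measure X) [IsProbabilityMeasure μ]
    {f : X → ℝ} (h0 : ∀ x, 0 ≤ f x) (h1 : ∀ x, f x ≤ 1) : ∫ x, f x ∂μ ≤ 1 := by
  have := integral_mono_of_nonneg (μ := μ) (f := f) (g := fun _ => (1 : ℝ))
    (Eventually.of_forall h0) (integrable_const _) (Eventually.of_forall h1)
  simpa using this

lemma abs_qret_le_one (d : ℕ) (lam : ℝ) (hlam : 0 < lam) (F : Measure ℝ)
    [IsProbabilityMeasure F] (hmom : Integrable (fun r : ℝ => r ^ d) F)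
    (G : Kernel ℝ ℝ) [IsMarkovKernel G] (u r₁ r₂ : ℝ) :
    |qret d lam F G u r₁ r₂| ≤ 1 := by
  have a0 : ∀ r, 0 ≤ havg d lam F G r := fun r => integral_nonneg fun w => (hret_pos _ _ _ _ _ _).le
  have a1 : ∀ r, havg d lam F G r ≤ 1 := fun r =>
    int_le_one _ (fun w => (hret_pos _ _ _ _ _ _).le) (fun w => hret_le_one _ _ hlam _ _ _ _)
  have i0 : ∀ w₁, 0 ≤ ∫ w₂, h2ret d lam F G u r₁ w₁ r₂ w₂ ∂(G r₂) := fun w₁ =>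
    integral_nonneg fun w => h2ret_nonneg _ _ _ _ _ _ _ _ _
  have i1 : ∀ w₁, ∫ w₂, h2ret d lam F G u r₁ w₁ r₂ w₂ ∂(G r₂) ≤ 1 := fun w₁ =>
    int_le_one _ (fun w => h2ret_nonneg _ _ _ _ _ _ _ _ _)
      (fun w => h2ret_le_one _ _ hlam _ hmom _ _ _ _ _ _)
  have b0 : 0 ≤ h2avg d lam F G u r₁ r₂ := integral_nonneg i0
  have b1 : h2avg d lam F G u r₁ r₂ ≤ 1 := int_le_one _ i0 i1
  have c0 := mul_nonneg (a0 r₁) (a0 r₂)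
  have c1 := mul_le_one₀ (a1 r₁) (a0 r₂) (a1 r₂)
  unfold qret
  rw [abs_le]
  constructor <;> linarith

lemma tailF_nonneg (F : Measure ℝ) (x : ℝ) : 0 ≤ tailF F x := ENNReal.toReal_nonneg

lemma tailF_pos {F : Measure ℝ} {α : ℝ} (hpow : IsPowerLaw F α) {x : ℝ} (hx : 0 < x) :
    0 < tailF F x := by
  obtain ⟨l, ⟨_, hl, _⟩, h⟩ := hpow
  rw [h x hx]
  exact mul_pos (hl x hx) (Real.rpow_pos_of_pos hx _)

lemma tail_ratio {F : Measure ℝ} {α : ℝ} (hpow : IsPowerLaw F α) {a : ℝ} (ha : 0 < a) :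
    Tendsto (fun t => tailF F (a * t) / tailF F t) atTop (nhds (a ^ (-α))) := by
  obtain ⟨l, ⟨_, hl, hs⟩, h⟩ := hpow
  have h1 := (hs a ha).mul_const (a ^ (-α))
  rw [one_mul] at h1
  refine h1.congr' ?_
  filter_upwards [eventually_gt_atTop 0] with t ht
  rw [h t ht, h (a * t) (mul_pos ha ht), Real.mul_rpow ha.le ht.le]
  have := (hl t ht).ne'
  have := (Real.rpow_pos_of_pos ht (-α)).ne'
  field_simp

lemma tail_ratio_bound {F : Measure ℝ} {α : ℝ} (hpow : IsPowerLaw F α) {a b : ℝ} (ha : 0 < a)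
    (hb : a ^ (-α) < b) : ∀ᶠ t in atTop, tailF F (a * t) ≤ b * tailF F t := by
  filter_upwards [(tail_ratio hpow ha).eventually_lt_const hb, eventually_gt_atTop 0] with t h1 h2
  exact ((div_lt_iff₀ (tailF_pos hpow h2)).1 h1).le

lemma karamata (d : ℕ) {F : Measure ℝ} [IsProbabilityMeasure F]
    (hmom : Integrable (fun r : ℝ => r ^ d) F)
    {α : ℝ} (hα : (d : ℝ) < α) (hpow : IsPowerLaw F α) :
    ∃ C : ℝ, 0 < C ∧ ∀ᶠ t in atTop, ∫ r in Ioi t, r ^ d ∂F ≤ C * (t ^ d * tailF F t) := by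
  have h2 : (2 : ℝ) ^ (-α) < (2 : ℝ) ^ (-(d : ℝ)) :=
    Real.rpow_lt_rpow_of_exponent_lt one_lt_two (by linarith)
  obtain ⟨ρ, hρ1, hρ2⟩ := exists_between h2
  have hρ0 : 0 < ρ := (Real.rpow_pos_of_pos two_pos _).trans hρ1
  have hθ : (2 : ℝ) ^ d * ρ < 1 := by
    rw [Real.rpow_neg two_pos.le, Real.rpow_natCast] at hρ2
    have := mul_lt_mul_of_pos_left hρ2 (show (0 : ℝ) < 2 ^ d by positivity)
    rwa [mul_inv_cancel₀ (by positivity)] at this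
  set θ := (2 : ℝ) ^ d * ρ with hθd
  have h1θ : 0 < 1 - θ := by linarith
  refine ⟨2 ^ d / (1 - θ), by positivity, ?_⟩
  set C := (2 : ℝ) ^ d / (1 - θ) with hC
  have hC0 : 0 < C := by positivity
  have hCeq : 2 ^ d + C * θ = C := by rw [hC]; field_simp; ring
  obtain ⟨T, hT⟩ := eventually_atTop.1 (tail_ratio_bound hpow two_pos hρ1)
  have hM0 : Tendsto (fun t : ℝ => ∫ r in Ioi t, r ^ d ∂F) atTop (nhds 0) := by
    have := tendsto_setIntegral_of_antitone (μ := F) (f := fun r : ℝ => r ^ d)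
      (s := fun t : ℝ => Ioi t) (fun _ => measurableSet_Ioi)
      (fun a b hab => Ioi_subset_Ioi hab) ⟨0, hmom.integrableOn⟩
    have he : (⋂ n : ℝ, Ioi n) = ∅ := by
      ext x
      simp only [mem_iInter, mem_Ioi, mem_empty_iff_false, iff_false, not_forall, not_lt]
      exact ⟨x, le_rfl⟩
    rw [he] at this
    simpa using this
  have step : ∀ t : ℝ, 0 < t → ∫ r in Ioi t, r ^ d ∂F ≤
      2 ^ d * (t ^ d * tailF F t) + ∫ r in Ioi (2 * t), r ^ d ∂F := by
    intro t ht
    have hun : Ioi t = Ioc t (2 * t) ∪ Ioi (2 * t) := (Ioc_union_Ioi_eq_Ioi (by linarith)).symm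
    rw [hun, setIntegral_union (Ioc_disjoint_Ioi le_rfl) measurableSet_Ioi
      hmom.integrableOn hmom.integrableOn]
    refine add_le_add ?_ le_rfl
    have : ∫ r in Ioc t (2 * t), r ^ d ∂F ≤ ∫ r in Ioc t (2 * t), (2 * t) ^ d ∂F := by
      refine setIntegral_mono_on hmom.integrableOn (integrable_const _).integrableOn
        measurableSet_Ioc ?_
      intro r hr
      exact pow_le_pow_left₀ (ht.le.trans hr.1.le) hr.2 d
    refine this.trans ?_
    rw [setIntegral_const, smul_eq_mul, mul_pow]
    have h3 : F.real (Ioc t (2 * t)) ≤ tailF F t :=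
      ENNReal.toReal_mono (measure_ne_top _ _) (measure_mono Ioc_subset_Ioi_self)
    calc _ ≤ tailF F t * (2 ^ d * t ^ d) := mul_le_mul_of_nonneg_right h3 (by positivity)
      _ = _ := by ring
  have ind : ∀ n : ℕ, ∀ t : ℝ, 0 < t → T ≤ t → ∫ r in Ioi t, r ^ d ∂F ≤
      C * (t ^ d * tailF F t) + ∫ r in Ioi (2 ^ n * t), r ^ d ∂F := by
    intro n
    induction n with
    | zero =>
      intro t ht _
      simp only [pow_zero, one_mul]
      have := tailF_nonneg F t
      have : 0 ≤ C * (t ^ d * tailF F t) := by positivity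
      linarith
    | succ n ih =>
      intro t ht hTt
      have a1 := step t ht
      have a2 := ih (2 * t) (by linarith) (by linarith)
      have a3 := hT t hTt
      rw [show (2 : ℝ) ^ (n + 1) * t = 2 ^ n * (2 * t) by ring]
      have a4 : C * ((2 * t) ^ d * tailF F (2 * t)) ≤ C * θ * (t ^ d * tailF F t) := by
        calc _ ≤ C * ((2 * t) ^ d * (ρ * tailF F t)) := by gcongr
          _ = _ := by rw [hθd, mul_pow]; ring
      have a5 : C * (t ^ d * tailF F t) =
          2 ^ d * (t ^ d * tailF F t) + C * θ * (t ^ d * tailF F t) := by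
        rw [← add_mul, hCeq]
      linarith
  filter_upwards [eventually_gt_atTop 0, eventually_ge_atTop T] with t ht hTt
  have hl : Tendsto (fun n : ℕ => (2 : ℝ) ^ n * t) atTop atTop :=
    (tendsto_pow_atTop_atTop_of_one_lt one_lt_two).atTop_mul_const ht
  have := (hM0.comp hl).const_add (C * (t ^ d * tailF F t))
  rw [add_zero] at this
  exact ge_of_tendsto' this fun n => ind n t ht hTt

lemma norm_e1 (d : ℕ) (hd : 0 < d) : ‖e1 d‖ = 1 := by
  unfold e1
  rw [dif_pos hd]
  simp

lemma IE_le (d : ℕ) (hd : 0 < d) (F : Measure ℝ)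
    [IsProbabilityMeasure F] (hmom : Integrable (fun r : ℝ => r ^ d) F)
    (G : Kernel ℝ ℝ) [IsMarkovKernel G] {u r₁ r₂ : ℝ} (w : ℝ) (hu : 0 < u) (h1 : 0 ≤ r₁)
    (h2 : 0 ≤ r₂) (h12 : r₁ + r₂ ≤ u / 2) :
    IE d F G u r₁ r₂ w ≤ kap d * 5 ^ d * ∫ r in Ioi (1 / 8 * u), r ^ d ∂F := by
  rw [← integral_const_mul, ← integral_indicator measurableSet_Ioi]
  refine integral_mono_of_nonneg (Eventually.of_forall fun _ =>
      mul_nonneg (interVol_nonneg _ _ _ _ _) ENNReal.toReal_nonneg)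
      ((hmom.const_mul _).indicator measurableSet_Ioi) (Eventually.of_forall fun r => ?_)
  by_cases hr : r ∈ Ioi (1 / 8 * u)
  · rw [indicator_of_mem hr]
    rw [mem_Ioi] at hr
    have hr0 : 0 < r := by linarith
    calc _ ≤ interVol d 0 (r + r₁) (u • e1 d) (r + r₂) * 1 :=
          mul_le_mul_of_nonneg_left (ker_le_one _ _ _) (interVol_nonneg _ _ _ _ _)
      _ ≤ ballVol d (r + r₁) := by rw [mul_one]; exact interVol_le_left _ _ _ _
      _ ≤ kap d * (5 * r) ^ d := ballVol_le d (by linarith) (by linarith)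
      _ = _ := by rw [mul_pow]; ring
  · rw [indicator_of_notMem hr]
    rw [mem_Ioi, not_lt] at hr
    have : closedBall (0 : Euc d) (r + r₁) ∩ closedBall (u • e1 d) (r + r₂) = ∅ := by
      ext x
      simp only [mem_inter_iff, mem_closedBall, mem_empty_iff_false, iff_false, not_and, not_le]
      intro hx
      by_contra hc
      rw [not_lt] at hc
      have h3 := dist_triangle_left (0 : Euc d) (u • e1 d) x
      rw [dist_zero_left, norm_smul, norm_e1 d hd, Real.norm_of_nonneg hu.le, mul_one] at h3
      linarith
    have : interVol d 0 (r + r₁) (u • e1 d) (r + r₂) = 0 := by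
      unfold interVol; rw [this]; simp
    simp [this]

lemma qret_bound (d : ℕ) (lam : ℝ) (hlam : 0 < lam) (F : Measure ℝ)
    [IsProbabilityMeasure F] (hmom : Integrable (fun r : ℝ => r ^ d) F)
    (G : Kernel ℝ ℝ) [IsMarkovKernel G] {u r₁ r₂ : ℝ}
    (h12 : r₁ + r₂ < u) {K : ℝ} (hK : ∀ w, IE d F G u r₁ r₂ w ≤ K) :
    |qret d lam F G u r₁ r₂| ≤ lam * K := by
  have bound : ∀ w₁ w₂, hret d lam F G r₁ w₁ * hret d lam F G r₂ w₂ ≤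
      h2ret d lam F G u r₁ w₁ r₂ w₂ ∧ h2ret d lam F G u r₁ w₁ r₂ w₂ ≤
      hret d lam F G r₁ w₁ * hret d lam F G r₂ w₂ + lam * K := by
    intro w₁ w₂
    have e1 := hret_pos d lam F G r₁ w₁
    have e2 := hret_pos d lam F G r₂ w₂
    have e3 := hret_le_one d lam hlam F G r₂ w₂
    have e4 := hret_mul_exp_le_one d lam hlam F hmom G u r₁ r₂ w₁ w₂
    have e5 := IE_nonneg d F G u r₁ r₂ (max w₁ w₂)
    have e6 := hK (max w₁ w₂)
    have heq : h2ret d lam F G u r₁ w₁ r₂ w₂ = hret d lam F G r₁ w₁ * hret d lam F G r₂ w₂ *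
        Real.exp (lam * IE d F G u r₁ r₂ (max w₁ w₂)) := by
      unfold h2ret IE
      rw [if_neg (not_le.2 h12)]
    rw [heq]
    set I := IE d F G u r₁ r₂ (max w₁ w₂)
    set a := hret d lam F G r₁ w₁
    set b := hret d lam F G r₂ w₂
    have hx : 0 ≤ lam * I := mul_nonneg hlam.le e5
    have hE : 1 ≤ Real.exp (lam * I) := Real.one_le_exp hx
    constructor
    · exact le_mul_of_one_le_right (mul_pos e1 e2).le hE
    · have h1 : Real.exp (lam * I) - 1 ≤ lam * I * Real.exp (lam * I) := by
        have := Real.add_one_le_exp (-(lam * I))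
        have h' := mul_le_mul_of_nonneg_right this (Real.exp_pos (lam * I)).le
        rw [← Real.exp_add, neg_add_cancel, Real.exp_zero] at h'
        linarith
      have h2 : a * b * (Real.exp (lam * I) - 1) ≤ a * b * (lam * I * Real.exp (lam * I)) :=
        mul_le_mul_of_nonneg_left h1 (mul_pos e1 e2).le
      have h3 : a * b * (lam * I * Real.exp (lam * I)) = (a * Real.exp (lam * I)) * b * (lam * I) := by
        ring
      have h4 : (a * Real.exp (lam * I)) * b ≤ 1 := mul_le_one₀ e4 e2.le e3
      have h5 := mul_le_mul_of_nonneg_right h4 hx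
      have h6 : lam * I ≤ lam * K := mul_le_mul_of_nonneg_left e6 hlam.le
      linarith
  have mh : ∀ r r' : ℝ, Integrable (fun w => hret d lam F G r w) (G r') := by
    intro r r'
    refine Integrable.of_bound (C := 1)
      (meas_hret d lam F G measurable_const measurable_id).aestronglyMeasurable ?_
    refine Eventually.of_forall fun w => ?_
    rw [Real.norm_of_nonneg (hret_pos _ _ _ _ _ _).le]
    exact hret_le_one _ _ hlam _ _ _ _
  have mh2 : ∀ w₁, Integrable (fun w₂ => h2ret d lam F G u r₁ w₁ r₂ w₂) (G r₂) := by
    intro w₁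
    refine Integrable.of_bound (C := 1) (meas_h2ret d lam F G u measurable_const measurable_const
      measurable_const measurable_id).aestronglyMeasurable ?_
    refine Eventually.of_forall fun w => ?_
    rw [Real.norm_of_nonneg (h2ret_nonneg _ _ _ _ _ _ _ _ _)]
    exact h2ret_le_one _ _ hlam _ hmom _ _ _ _ _ _
  have b2 : ∀ w₁, hret d lam F G r₁ w₁ * havg d lam F G r₂ ≤
      ∫ w₂, h2ret d lam F G u r₁ w₁ r₂ w₂ ∂(G r₂) ∧
      ∫ w₂, h2ret d lam F G u r₁ w₁ r₂ w₂ ∂(G r₂) ≤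
      hret d lam F G r₁ w₁ * havg d lam F G r₂ + lam * K := by
    intro w₁
    unfold havg
    rw [← integral_const_mul]
    constructor
    · exact integral_mono ((mh _ _).const_mul _) (mh2 _) fun w => (bound w₁ w).1
    · have := integral_mono (mh2 w₁) (((mh r₂ r₂).const_mul (hret d lam F G r₁ w₁)).add
        (integrable_const (lam * K))) fun w => (bound w₁ w).2
      refine this.trans (le_of_eq ?_)
      simp only [Pi.add_apply]
      rw [integral_add ((mh _ _).const_mul _) (integrable_const _)]
      simp
  have mI : Integrable (fun w₁ => ∫ w₂, h2ret d lam F G u r₁ w₁ r₂ w₂ ∂(G r₂)) (G r₁) := by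
    refine Integrable.of_bound (C := 1) ?_ ?_
    · have h : Measurable (fun x : ℝ × ℝ => h2ret d lam F G u r₁ x.1 r₂ x.2) :=
        meas_h2ret d lam F G u measurable_const measurable_fst measurable_const measurable_snd
      exact (h.stronglyMeasurable.integral_prod_right' (ν := G r₂)).aestronglyMeasurable
    · refine Eventually.of_forall fun w₁ => ?_
      rw [Real.norm_of_nonneg (integral_nonneg fun w => h2ret_nonneg _ _ _ _ _ _ _ _ _)]
      exact int_le_one _ (fun w => h2ret_nonneg _ _ _ _ _ _ _ _ _)
        (fun w => h2ret_le_one _ _ hlam _ hmom _ _ _ _ _ _)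
  have c1 := integral_mono ((mh r₁ r₁).mul_const (havg d lam F G r₂)) mI fun w => (b2 w).1
  have c2 := integral_mono mI (((mh r₁ r₁).mul_const (havg d lam F G r₂)).add
        (integrable_const (lam * K))) fun w => (b2 w).2
  simp only [Pi.add_apply] at c2
  rw [integral_add ((mh _ _).mul_const _) (integrable_const _), integral_mul_const] at c2
  rw [integral_mul_const] at c1
  simp only [integral_const, probReal_univ, one_smul] at c2
  have hK0 : 0 ≤ K := (IE_nonneg d F G u r₁ r₂ 0).trans (hK 0)
  have := mul_nonneg hlam.le hK0
  unfold qret h2avg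
  change _ ≤ _ at c1
  have t1 : havg d lam F G r₁ = ∫ w, hret d lam F G r₁ w ∂(G r₁) := rfl
  rw [← t1] at c1 c2
  rw [abs_le]
  constructor <;> linarith

lemma main_u (d : ℕ) (hd : 0 < d) (lam : ℝ) (hlam : 0 < lam)
    (F : Measure ℝ) [IsProbabilityMeasure F] (hsupp : F (Iio 0) = 0)
    (hmom : Integrable (fun r : ℝ => r ^ d) F)
    (α : ℝ) (hα : (d : ℝ) < α) (hpow : IsPowerLaw F α)
    (G : Kernel ℝ ℝ) [IsMarkovKernel G]
    (qinf : ℝ → ℝ → ℝ)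
    (hq : ∀ r₁ r₂ : ℝ, 0 ≤ r₁ → 0 ≤ r₂ →
      Tendsto (fun u : ℝ => qret d lam F G u r₁ r₂ / (u ^ d * tailF F u))
        atTop (nhds (qinf r₁ r₂))) :
    Tendsto (fun u : ℝ => (∫ r₁, (∫ r₂, qret d lam F G u r₁ r₂ ∂F) ∂F) / (u ^ d * tailF F u))
      atTop (nhds (∫ r₁, (∫ r₂, qinf r₁ r₂ ∂F) ∂F)) := by
  set P : Measure (ℝ × ℝ) := F.prod F with hP
  set A : ℝ → Set (ℝ × ℝ) := fun u => {p | p.1 + p.2 ≤ u / 2} with hA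
  have hAm : ∀ u, MeasurableSet (A u) := fun u =>
    measurableSet_le (measurable_fst.add measurable_snd) measurable_const
  have hmeas : ∀ u, Measurable (fun p : ℝ × ℝ => qret d lam F G u p.1 p.2 / (u ^ d * tailF F u)) :=
    fun u => (meas_qret d lam F G u).div_const _
  have hqint : ∀ u, Integrable (fun p : ℝ × ℝ => qret d lam F G u p.1 p.2) P := fun u =>
    Integrable.of_bound (C := 1) (meas_qret d lam F G u).aestronglyMeasurable
      (Eventually.of_forall fun p => abs_qret_le_one d lam hlam F hmom G u p.1 p.2)
  have hpos : ∀ᵐ p ∂P, 0 ≤ p.1 ∧ 0 ≤ p.2 := by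
    have h0 : ∀ᵐ r ∂F, 0 ≤ r := by
      rw [ae_iff]
      simpa [Iio, not_le] using hsupp
    have a1 : ∀ᵐ p ∂P, 0 ≤ p.1 := Measure.quasiMeasurePreserving_fst.ae h0
    have a2 : ∀ᵐ p ∂P, 0 ≤ p.2 := Measure.quasiMeasurePreserving_snd.ae h0
    filter_upwards [a1, a2] with p b1 b2 using ⟨b1, b2⟩
  -- uniform bound on the main region
  obtain ⟨K, hK0, hK⟩ := karamata d hmom hα hpow
  obtain ⟨B, hB⟩ := exists_gt ((1 / 8 : ℝ) ^ (-α))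
  have h8 := tail_ratio_bound hpow (a := 1 / 8) (by norm_num) hB
  have hK8 : ∀ᶠ u : ℝ in atTop, ∫ r in Ioi (1 / 8 * u), r ^ d ∂F ≤
      K * ((1 / 8 * u) ^ d * tailF F (1 / 8 * u)) :=
    (tendsto_id.const_mul_atTop (show (0 : ℝ) < 1 / 8 by norm_num)).eventually hK
  set C := lam * (kap d * 5 ^ d * (K * ((1 / 8) ^ d * B))) with hC
  have hbound : ∀ᶠ u in atTop, ∀ᵐ p ∂P,
      ‖(A u).indicator (fun p : ℝ × ℝ => qret d lam F G u p.1 p.2 / (u ^ d * tailF F u)) p‖ ≤ C := by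
    filter_upwards [h8, hK8, eventually_gt_atTop 0] with u hu8 huK hu0
    have hN : 0 < u ^ d * tailF F u := mul_pos (pow_pos hu0 d) (tailF_pos hpow hu0)
    have hB0 : 0 < B := (Real.rpow_pos_of_pos (by norm_num) _).trans hB
    have hk := kap_nonneg d
    have hC0 : 0 ≤ C := by positivity
    filter_upwards [hpos] with p hp
    by_cases hpA : p ∈ A u
    · rw [indicator_of_mem hpA, norm_div, Real.norm_of_nonneg hN.le, div_le_iff₀ hN,
        Real.norm_eq_abs]
      have hpA' : p.1 + p.2 ≤ u / 2 := hpA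
      refine (qret_bound d lam hlam F hmom G (by linarith)
        (fun w => IE_le d hd F hmom G w hu0 hp.1 hp.2 hpA')).trans ?_
      have : ∫ r in Ioi (1 / 8 * u), r ^ d ∂F ≤ K * ((1 / 8 * u) ^ d * (B * tailF F u)) :=
        huK.trans (by gcongr)
      calc _ ≤ lam * (kap d * 5 ^ d * (K * ((1 / 8 * u) ^ d * (B * tailF F u)))) := by gcongr
        _ = _ := by rw [hC, mul_pow]; ring
    · rw [indicator_of_notMem hpA, norm_zero]; exact hC0
  have hlim : ∀ᵐ p ∂P, Tendsto (fun u => (A u).indicator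
      (fun p : ℝ × ℝ => qret d lam F G u p.1 p.2 / (u ^ d * tailF F u)) p) atTop
      (nhds (qinf p.1 p.2)) := by
    filter_upwards [hpos] with p hp
    refine (hq p.1 p.2 hp.1 hp.2).congr' ?_
    filter_upwards [eventually_ge_atTop (2 * (p.1 + p.2))] with u hu
    have : p ∈ A u := by
      change p.1 + p.2 ≤ u / 2
      linarith
    rw [indicator_of_mem this]
  have hm' : ∀ u, AEStronglyMeasurable ((A u).indicator
      (fun p : ℝ × ℝ => qret d lam F G u p.1 p.2 / (u ^ d * tailF F u))) P := fun u =>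
    ((hmeas u).indicator (hAm u)).aestronglyMeasurable
  have hmain := tendsto_integral_filter_of_dominated_convergence (fun _ => C)
    (Eventually.of_forall hm') hbound (integrable_const C) hlim
  -- integrability of the limit
  have hqi : Integrable (fun p : ℝ × ℝ => qinf p.1 p.2) P := by
    have hae := aestronglyMeasurable_of_tendsto_ae atTop hm' hlim
    refine Integrable.of_bound (C := C) hae ?_
    obtain ⟨T, hT⟩ := eventually_atTop.1 hbound
    have hall : ∀ᵐ p ∂P, ∀ n : ℕ, ‖(A (T + n)).indicator (fun p : ℝ × ℝ =>
        qret d lam F G (T + n) p.1 p.2 / ((T + n) ^ d * tailF F (T + n))) p‖ ≤ C :=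
      ae_all_iff.2 fun n => hT _ (by simp)
    filter_upwards [hall, hlim] with p h1 h2
    have hn : Tendsto (fun n : ℕ => T + (n : ℝ)) atTop atTop :=
      tendsto_atTop_add_const_left _ _ tendsto_natCast_atTop_atTop
    exact le_of_tendsto' (h2.comp hn).norm h1
  -- the remaining region
  obtain ⟨B', hB'⟩ := exists_gt ((1 / 4 : ℝ) ^ (-α))
  have h4 := tail_ratio_bound hpow (a := 1 / 4) (by norm_num) hB'
  have hrest : Tendsto (fun u => ∫ p, (A u)ᶜ.indicator
      (fun p : ℝ × ℝ => qret d lam F G u p.1 p.2 / (u ^ d * tailF F u)) p ∂P) atTop (nhds 0) := by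
    have hz : Tendsto (fun u : ℝ => 2 * B' / u ^ d) atTop (nhds 0) :=
      tendsto_const_nhds.div_atTop (tendsto_pow_atTop hd.ne')
    refine squeeze_zero_norm' ?_ hz
    filter_upwards [h4, eventually_gt_atTop 0] with u hu4 hu0
    have ht := tailF_pos hpow hu0
    have hN : 0 < u ^ d * tailF F u := mul_pos (pow_pos hu0 d) ht
    rw [integral_indicator (hAm u).compl]
    have h1 := norm_setIntegral_le_of_norm_le_const (μ := P) (s := (A u)ᶜ)
      (f := fun p : ℝ × ℝ => qret d lam F G u p.1 p.2 / (u ^ d * tailF F u))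
      (C := 1 / (u ^ d * tailF F u)) (measure_lt_top _ _) (fun p _ => by
        rw [norm_div, Real.norm_of_nonneg hN.le, Real.norm_eq_abs]
        exact div_le_div_of_nonneg_right (abs_qret_le_one d lam hlam F hmom G u p.1 p.2) hN.le)
    refine h1.trans ?_
    have h2 : P.real (A u)ᶜ ≤ 2 * tailF F (1 / 4 * u) := by
      have hsub : (A u)ᶜ ⊆ (Ioi (1 / 4 * u) ×ˢ univ) ∪ (univ ×ˢ Ioi (1 / 4 * u)) := by
        intro p hp
        have hp' : ¬ (p.1 + p.2 ≤ u / 2) := hp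
        simp only [mem_union, mem_prod, mem_Ioi, mem_univ, and_true, true_and]
        by_contra hc
        rw [not_or, not_lt, not_lt] at hc
        exact hp' (by linarith [hc.1, hc.2])
      have e1 : P.real (Ioi (1 / 4 * u) ×ˢ univ) = tailF F (1 / 4 * u) := by
        rw [hP, measureReal_def, Measure.prod_prod]; simp [tailF]
      have e2 : P.real (univ ×ˢ Ioi (1 / 4 * u)) = tailF F (1 / 4 * u) := by
        rw [hP, measureReal_def, Measure.prod_prod]; simp [tailF]
      calc _ ≤ _ := measureReal_mono hsub
        _ ≤ _ := measureReal_union_le _ _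
        _ = _ := by rw [e1, e2]; ring
    calc _ ≤ 1 / (u ^ d * tailF F u) * (2 * (B' * tailF F u)) := by gcongr; linarith
      _ = _ := by field_simp
  have hsum := hmain.add hrest
  rw [add_zero, integral_prod _ hqi] at hsum
  refine hsum.congr fun u => ?_
  have i0 := (hqint u).div_const (u ^ d * tailF F u)
  rw [← integral_add (i0.indicator (hAm u)) (i0.indicator (hAm u).compl)]
  rw [← integral_prod _ (hqint u), ← integral_div]
  refine integral_congr_ae (Eventually.of_forall fun p => ?_)
  exact congrFun (indicator_self_add_compl (A u) _) p

/-- Asymptotics of the two-point correlation function of the thinned grain centers,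
assuming the decay `q(|z|,r₁,r₂) ∼ q_∞(r₁,r₂) |z|^d F̄(|z|)`. -/
theorem stmt12 (d : ℕ) (hd : 0 < d) (lam : ℝ) (hlam : 0 < lam)
    (F : Measure ℝ) [IsProbabilityMeasure F] (hsupp : F (Iio 0) = 0)
    (hmom : Integrable (fun r : ℝ => r ^ d) F)
    (α : ℝ) (hα : (d : ℝ) < α) (hpow : IsPowerLaw F α)
    (G : Kernel ℝ ℝ) [IsMarkovKernel G]
    (qinf : ℝ → ℝ → ℝ)
    (hq : ∀ r₁ r₂ : ℝ, 0 ≤ r₁ → 0 ≤ r₂ →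
      Tendsto (fun z : Euc d => qret d lam F G ‖z‖ r₁ r₂ / (‖z‖ ^ d * tailF F ‖z‖))
        (comap norm atTop) (nhds (qinf r₁ r₂))) :
    Tendsto
      (fun z : Euc d =>
        xith d lam F (havg d lam F G) (qret d lam F G) z / (‖z‖ ^ d * tailF F ‖z‖))
      (comap norm atTop)
      (nhds ((lam / lamth lam F (havg d lam F G)) ^ 2 *
        ∫ r₁, (∫ r₂, qinf r₁ r₂ ∂F) ∂F)) := by

  have hq' : ∀ r₁ r₂ : ℝ, 0 ≤ r₁ → 0 ≤ r₂ →
      Tendsto (fun u : ℝ => qret d lam F G u r₁ r₂ / (u ^ d * tailF F u))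
        atTop (nhds (qinf r₁ r₂)) := by
    intro r₁ r₂ h1 h2
    have hn : ∀ u : ℝ, 0 ≤ u → ‖u • e1 d‖ = u := fun u hu => by
      rw [norm_smul, norm_e1 d hd, Real.norm_of_nonneg hu, mul_one]
    have ht : Tendsto (fun u : ℝ => u • e1 d) atTop (comap norm atTop) := by
      rw [tendsto_comap_iff]
      refine tendsto_id.congr' ?_
      filter_upwards [eventually_ge_atTop 0] with u hu
      exact (hn u hu).symm
    refine ((hq r₁ r₂ h1 h2).comp ht).congr' ?_
    filter_upwards [eventually_ge_atTop 0] with u hu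
    simp only [Function.comp_apply, hn u hu]
  have h := (main_u d hd lam hlam F hsupp hmom α hα hpow G qinf hq').comp
    (tendsto_comap (f := fun z : Euc d => ‖z‖))
  have h' := h.const_mul ((lam / lamth lam F (havg d lam F G)) ^ 2)
  refine h'.congr fun z => ?_
  unfold xith
  simp only [Function.comp_apply]
  rw [mul_div_assoc]
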